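/- arXiv:1303.2249 — 13 statements merged into one kernel-verified Lean document; each statement's English description precedes it below -/
import Mathlib

section
/- Let C ≥ 2 be an integer. Suppose a positive integer n satisfies n = A·B = (A + a₁)·(B − b₁) = (A + a₂)·(B − b₂) for positive integers A, B, a₁, a₂, b₁, b₂ with 1 ≤ a₁ < a₂ ≤ C and 1 ≤ b₁ < b₂ ≤ C. Then A < C³ and B < C³. -/
/-- If a positive multiple of `X` equals `x * y * (v - u)` with `0 < x < y ≤ C` and
`0 < u < v ≤ C`, then `X < C ^ 3`. -/
lemma lt_cube_of_mul_eq {C X D x y u v : ℤ} (hX : 0 < X) (hx : 0 < x) (hxy : x < y) (hy : y ≤ C)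
    (hu : 0 < u) (huv : u < v) (hv : v ≤ C) (h : X * D = x * y * (v - u)) : X < C ^ 3 := by
  have hy0 : 0 < y := hx.trans hxy
  have hC : 0 < C := hy0.trans_le hy
  have hvu : 0 < v - u := sub_pos.mpr huv
  have hD : 0 < D := pos_of_mul_pos_right (h ▸ by positivity) hX.le
  calc X ≤ X * D := le_mul_of_one_le_right hX.le hD
    _ = x * y * (v - u) := h
    _ ≤ C * C * (v - u) := by gcongr; exact hxy.le.trans hy
    _ < C * C * C := by gcongr; linarith
    _ = C ^ 3 := by ring

/-- Theorem 1: If `n = A·B = (A+a₁)·(B−b₁) = (A+a₂)·(B−b₂)` with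
`1 ≤ a₁ < a₂ ≤ C` and `1 ≤ b₁ < b₂ ≤ C`, then `A, B < C³`. -/
theorem three_close_factorizations_bound (C n A B a₁ a₂ b₁ b₂ : ℕ)
    (hC : 2 ≤ C) (hn : 0 < n) (hA : 0 < A) (hB : 0 < B)
    (ha₁ : 1 ≤ a₁) (ha₁₂ : a₁ < a₂) (ha₂ : a₂ ≤ C)
    (hb₁ : 1 ≤ b₁) (hb₁₂ : b₁ < b₂) (hb₂ : b₂ ≤ C)
    (h0 : n = A * B)
    (h1 : n = (A + a₁) * (B - b₁))
    (h2 : n = (A + a₂) * (B - b₂)) :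
    A < C ^ 3 ∧ B < C ^ 3 := by
  have hB₂ : b₂ < B := by
    by_contra! h
    simp [Nat.sub_eq_zero_of_le h] at h2
    omega
  have e₁ : (A * B : ℤ) = (A + a₁) * (B - b₁) := by
    have h := h0.symm.trans h1
    zify [(hb₁₂.trans hB₂).le] at h
    exact h
  have e₂ : (A * B : ℤ) = (A + a₂) * (B - b₂) := by
    have h := h0.symm.trans h2
    zify [hB₂.le] at h
    exact h
  zify at *
  constructor
  · refine lt_cube_of_mul_eq (D := a₂ * b₁ - a₁ * b₂) hA ha₁ ha₁₂ ha₂ hb₁ hb₁₂ hb₂ ?_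
    linear_combination a₂ * e₁ - a₁ * e₂
  · refine lt_cube_of_mul_eq (D := a₂ * b₁ - a₁ * b₂) hB hb₁ hb₁₂ hb₂ ha₁ ha₁₂ ha₂ ?_
    linear_combination b₂ * e₁ - b₁ * e₂
end

section
/- Let C ≥ 10 be an integer. Suppose a positive integer n satisfies n = A·B = (A + a₁)·(B − b₁) = (A + a₂)·(B − b₂) for positive integers A, B, a₁, a₂, b₁, b₂ with 1 ≤ a₁ < a₂ ≤ C and 1 ≤ b₁ < b₂ ≤ C. Then A ≤ (C³ − 2C² + C)/4 and B ≤ (C³ − 2C² + C)/4 (equivalently, 4A ≤ C³ − 2C² + C and 4B ≤ C³ − 2C² + C). -/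
/-- The AM-GM bound `4 x (y - x) z ≤ M² N` for `0 ≤ y ≤ M` and `0 ≤ z ≤ N`. -/
lemma four_mul_mul_sub_mul_le {x y z M N : ℤ} (hy : 0 ≤ y) (hyM : y ≤ M) (hz : 0 ≤ z)
    (hzN : z ≤ N) : 4 * (x * (y - x) * z) ≤ M ^ 2 * N := by
  have hxy : 4 * (x * (y - x)) ≤ y ^ 2 := by nlinarith [sq_nonneg (y - 2 * x)]
  have hyM2 : y ^ 2 ≤ M ^ 2 := pow_le_pow_left₀ hy hyM 2
  calc 4 * (x * (y - x) * z) = 4 * (x * (y - x)) * z := by ring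
    _ ≤ M ^ 2 * z := mul_le_mul_of_nonneg_right (hxy.trans hyM2) hz
    _ ≤ M ^ 2 * N := mul_le_mul_of_nonneg_left hzN (sq_nonneg M)

section

variable {C A B a₁ a₂ b₁ b₂ : ℤ}

lemma four_mul_left_le (hC : 10 ≤ C) (hA : 0 < A)
    (ha₁ : 1 ≤ a₁) (ha₁₂ : a₁ < a₂) (ha₂ : a₂ ≤ C)
    (hb₁ : 1 ≤ b₁) (hb₁₂ : b₁ < b₂) (hb₂ : b₂ ≤ C)
    (hD : 0 < a₂ * b₁ - a₁ * b₂)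
    (h : (A + a₁) * (a₂ * b₁ - a₁ * b₂) = a₁ * (a₂ - a₁) * b₂) :
    4 * A ≤ C * (C - 1) ^ 2 := by
  rcases (show a₂ * b₁ - a₁ * b₂ = 1 ∨ 2 ≤ a₂ * b₁ - a₁ * b₂ by omega) with h1 | h2
  · rw [h1, mul_one] at h
    rcases (show a₂ ≤ C - 1 ∨ a₂ = C by omega) with ha | rfl
    · have := four_mul_mul_sub_mul_le (x := a₁) (by omega) ha (by omega) hb₂
      linarith
    rcases (show b₂ ≤ a₂ - 2 ∨ b₂ = a₂ - 1 ∨ b₂ = a₂ by omega) with hb | rfl | rfl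
    · have := four_mul_mul_sub_mul_le (x := a₁) (by omega) ha₂ (by omega) hb
      nlinarith
    · have hdvd : a₂ ∣ a₁ - 1 := ⟨a₁ - b₁, by linarith⟩
      have := Int.eq_zero_of_dvd_of_nonneg_of_lt (by omega) (by omega) hdvd
      obtain rfl : a₁ = 1 := by omega
      nlinarith [sq_nonneg (a₂ - 1)]
    · have hdvd : b₂ ∣ 1 := ⟨b₁ - a₁, by linarith⟩
      have := Int.le_of_dvd one_pos hdvd
      omega
  · have := four_mul_mul_sub_mul_le (x := a₁) (by omega) ha₂ (by omega) hb₂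
    have : (A + a₁) * 2 ≤ (A + a₁) * (a₂ * b₁ - a₁ * b₂) :=
      mul_le_mul_of_nonneg_left h2 (by omega)
    nlinarith [mul_nonneg (show 0 ≤ C by omega) (show 0 ≤ (C - 10) * C + 6 * C by nlinarith)]

lemma four_mul_right_le (hC : 10 ≤ C) (hBb : b₁ < B)
    (ha₁ : 1 ≤ a₁) (ha₁₂ : a₁ < a₂) (ha₂ : a₂ ≤ C)
    (hb₁ : 1 ≤ b₁) (hb₁₂ : b₁ < b₂) (hb₂ : b₂ ≤ C)
    (hD : 0 < a₂ * b₁ - a₁ * b₂)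
    (h : (B - b₁) * (a₂ * b₁ - a₁ * b₂) = b₁ * (b₂ - b₁) * a₂) :
    4 * B ≤ C * (C - 1) ^ 2 := by
  have hCC : 0 ≤ C * (C - 10) := mul_nonneg (by omega) (by omega)
  rcases (show a₂ * b₁ - a₁ * b₂ = 1 ∨ 2 ≤ a₂ * b₁ - a₁ * b₂ by omega) with h1 | h2
  · rw [h1, mul_one] at h
    rcases (show b₂ ≤ C - 1 ∨ b₂ = C by omega) with hb | rfl
    · rcases (show a₂ ≤ C - 1 ∨ a₂ = C by omega) with ha | rfl
      · have := four_mul_mul_sub_mul_le (x := b₁) (by omega) hb (by omega) ha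
        nlinarith
      rcases (show b₂ ≤ a₂ - 2 ∨ b₂ = a₂ - 1 by omega) with hb | rfl
      · have := four_mul_mul_sub_mul_le (x := b₁) (by omega) hb (by omega) ha₂
        nlinarith
      · have hdvd : a₂ - 1 ∣ b₁ - 1 := ⟨a₁ - b₁, by linarith⟩
        have := Int.eq_zero_of_dvd_of_nonneg_of_lt (by omega) (by omega) hdvd
        obtain rfl : b₁ = 1 := by omega
        nlinarith
    · rcases (show a₂ ≤ b₂ - 3 ∨ a₂ = b₂ - 2 ∨ a₂ = b₂ - 1 ∨ a₂ = b₂ by omega)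
        with ha | rfl | rfl | rfl
      · have := four_mul_mul_sub_mul_le (x := b₁) (by omega) hb₂ (by omega) ha
        nlinarith
      · rcases (show 2 * b₁ = b₂ ∨ 2 * b₁ = b₂ + 1 ∨ 2 * b₁ ≤ b₂ - 1 ∨ b₂ + 2 ≤ 2 * b₁ by omega)
          with rfl | hb | hb | hb
        · have hdvd : b₁ ∣ 1 := ⟨2 * b₁ - 2 - 2 * a₁, by linarith⟩
          have := Int.le_of_dvd one_pos hdvd
          omega
        · obtain rfl : b₂ = 2 * b₁ - 1 := by omega
          have hdvd : 2 * b₁ - 1 ∣ 2 := ⟨b₁ - 1 - a₁, by linarith⟩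
          have := Int.le_of_dvd two_pos hdvd
          omega
        · obtain ⟨s, hs⟩ : ∃ s, s = b₂ - 2 * b₁ := ⟨_, rfl⟩
          have hs1 : 1 ≤ s := by omega
          have hsq : (b₂ - 2) * 1 ≤ (b₂ - 2) * s ^ 2 :=
            mul_le_mul_of_nonneg_left (by nlinarith) (by omega)
          obtain rfl : b₂ = s + 2 * b₁ := by omega
          nlinarith
        · obtain ⟨s, hs⟩ : ∃ s, s = 2 * b₁ - b₂ := ⟨_, rfl⟩
          have hs2 : 2 ≤ s := by omega
          have hsq : (b₂ - 2) * (2 * s) ≤ (b₂ - 2) * s ^ 2 :=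
            mul_le_mul_of_nonneg_left (by nlinarith) (by omega)
          have : (b₂ - 3) * 2 ≤ (b₂ - 3) * s :=
            mul_le_mul_of_nonneg_left hs2 (by omega)
          obtain rfl : b₂ = 2 * b₁ - s := by omega
          nlinarith
      · have hdvd : b₂ ∣ b₂ - 1 - b₁ := ⟨1 - b₁ + a₁, by linarith⟩
        have := Int.eq_zero_of_dvd_of_nonneg_of_lt (by omega) (by omega) hdvd
        obtain rfl : b₁ = b₂ - 1 := by omega
        nlinarith
      · have hdvd : a₂ ∣ 1 := ⟨b₁ - a₁, by linarith⟩
        have := Int.le_of_dvd one_pos hdvd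
        omega
  · have := four_mul_mul_sub_mul_le (x := b₁) (by omega) hb₂ (by omega) ha₂
    have : (B - b₁) * 2 ≤ (B - b₁) * (a₂ * b₁ - a₁ * b₂) :=
      mul_le_mul_of_nonneg_left h2 (by omega)
    nlinarith

end

/-- Theorem 2: If `C ≥ 10` and `n = A·B = (A+a₁)·(B−b₁) = (A+a₂)·(B−b₂)` with
`1 ≤ a₁ < a₂ ≤ C` and `1 ≤ b₁ < b₂ ≤ C`, then
`A, B ≤ (C³ − 2C² + C)/4`, i.e. `4A ≤ C³ − 2C² + C` and `4B ≤ C³ − 2C² + C`. -/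
theorem three_close_factorizations_sharp_bound (C n A B a₁ a₂ b₁ b₂ : ℕ)
    (hC : 10 ≤ C) (hn : 0 < n) (hA : 0 < A) (hB : 0 < B)
    (ha₁ : 1 ≤ a₁) (ha₁₂ : a₁ < a₂) (ha₂ : a₂ ≤ C)
    (hb₁ : 1 ≤ b₁) (hb₁₂ : b₁ < b₂) (hb₂ : b₂ ≤ C)
    (h0 : n = A * B)
    (h1 : n = (A + a₁) * (B - b₁))
    (h2 : n = (A + a₂) * (B - b₂)) :
    4 * A ≤ C ^ 3 - 2 * C ^ 2 + C ∧ 4 * B ≤ C ^ 3 - 2 * C ^ 2 + C := by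
  have hb₁B : b₁ < B := by
    by_contra! hle
    simp [Nat.sub_eq_zero_of_le hle] at h1
    omega
  have hb₂B : b₂ < B := by
    by_contra! hle
    simp [Nat.sub_eq_zero_of_le hle] at h2
    omega
  have hsub : 2 * C ^ 2 ≤ C ^ 3 := by nlinarith [sq_nonneg C]
  subst h0
  zify [hb₁B.le, hb₂B.le, hsub] at *
  have hAD : (A : ℤ) * (a₂ * b₁ - a₁ * b₂) = a₁ * a₂ * (b₂ - b₁) := by
    linear_combination a₂ * h1 - a₁ * h2
  have hBD : (B : ℤ) * (a₂ * b₁ - a₁ * b₂) = b₁ * b₂ * (a₂ - a₁) := by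
    linear_combination b₂ * h1 - b₁ * h2
  have hD : (0 : ℤ) < a₂ * b₁ - a₁ * b₂ := by
    refine pos_of_mul_pos_right (a := (A : ℤ)) ?_ hA.le
    rw [hAD]
    exact mul_pos (mul_pos (by omega) (by omega)) (by omega)
  have hCube : (C : ℤ) ^ 3 - 2 * C ^ 2 + C = C * (C - 1) ^ 2 := by ring
  rw [hCube]
  exact ⟨four_mul_left_le hC hA ha₁ ha₁₂ ha₂ hb₁ hb₁₂ hb₂ hD (by linear_combination hAD),
    four_mul_right_le hC hb₁B ha₁ ha₁₂ ha₂ hb₁ hb₁₂ hb₂ hD (by linear_combination hBD)⟩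
end

section
/- For every integer N ≥ 4, set C = 2N + 3, n = N·(N+1)²·(N+2)·(2N+1)·(2N+3), A = (2N+1)·N·(N+2), B = (2N+3)·(N+1)², a₁ = N, a₂ = 2N+1, b₁ = N+1, b₂ = 2N+3. Then 1 ≤ a₁ < a₂ ≤ C, 1 ≤ b₁ < b₂ ≤ C, C ≥ 10, n = A·B = (A + a₁)·(B − b₁) = (A + a₂)·(B − b₂), and max(A, B) = B = (C³ − 2C² + C)/4. In particular, the upper bound (C³ − 2C² + C)/4 in the preceding theorem is attained for infinitely many n. -/
/-- The extremal example: for `N ≥ 4`, with `C = 2N+3` and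
`n = N(N+1)²(N+2)(2N+1)(2N+3)`, the number `n` has three close factorizations
with increments/decrements at most `C`, and `max(A,B) = B = (C³ − 2C² + C)/4`. -/
theorem extremal_example_three_factorizations (N : ℕ) (hN : 4 ≤ N) :
    let C := 2 * N + 3
    let n := N * (N + 1) ^ 2 * (N + 2) * (2 * N + 1) * (2 * N + 3)
    let A := (2 * N + 1) * N * (N + 2)
    let B := (2 * N + 3) * (N + 1) ^ 2
    let a₁ := N
    let a₂ := 2 * N + 1
    let b₁ := N + 1
    let b₂ := 2 * N + 3
    1 ≤ a₁ ∧ a₁ < a₂ ∧ a₂ ≤ C ∧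
    1 ≤ b₁ ∧ b₁ < b₂ ∧ b₂ ≤ C ∧
    10 ≤ C ∧
    n = A * B ∧
    n = (A + a₁) * (B - b₁) ∧
    n = (A + a₂) * (B - b₂) ∧
    max A B = B ∧
    4 * B = C ^ 3 - 2 * C ^ 2 + C := by
  intro C n A B a₁ a₂ b₁ b₂
  have h₁ : B - b₁ = (N + 1) * (2 * N + 1) * (N + 2) :=
    Nat.sub_eq_of_eq_add (by simp only [B, b₁]; ring)
  have h₂ : B - b₂ = (2 * N + 3) * N * (N + 2) :=
    Nat.sub_eq_of_eq_add (by simp only [B, b₂]; ring)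
  have h₃ : 2 * C ^ 2 ≤ C ^ 3 := by
    rw [pow_succ' C 2]
    exact Nat.mul_le_mul_right _ (by omega)
  refine ⟨by omega, by omega, by omega, by omega, by omega, by omega, by omega, ?_, ?_, ?_,
    max_eq_right ?_, ?_⟩
  · simp only [n, A, B]; ring
  · rw [h₁]; simp only [n, A, a₁]; ring
  · rw [h₂]; simp only [n, A, a₂]; ring
  · simp only [A, B]; nlinarith
  · zify [h₃]
    simp only [B, C]
    push_cast
    ring
end

section
/- Suppose (x₁, y₁), (x₂, y₂), (x₃, y₃) are three points with positive integer coordinates lying on the hyperbola x·y = n (n a positive integer), with x₁ < x₂ < x₃. Then max(x₃ − x₁, y₁ − y₃) > 2^{2/3}·n^{1/6} + 0.5 (as real numbers). -/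
/-- For three points `x * y = n`, with gaps `a`, `b` between the abscissae and `a'`, `b'` between
the ordinates, the determinant `D = a' * b - a * b'` satisfies
`n * D ^ 2 = a * b * (a + b) * (a' * b' * (a' + b'))`. -/
theorem hyperbola_mul_det_sq {n x₁ y₁ x₂ y₂ x₃ y₃ : ℤ}
    (hx₁ : x₁ ≠ 0) (hx₂ : x₂ ≠ 0) (hx₃ : x₃ ≠ 0)
    (h1 : x₁ * y₁ = n) (h2 : x₂ * y₂ = n) (h3 : x₃ * y₃ = n) :
    n * ((y₁ - y₂) * (x₃ - x₂) - (x₂ - x₁) * (y₂ - y₃)) ^ 2 =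
      (x₂ - x₁) * (x₃ - x₂) * (x₃ - x₁) * ((y₁ - y₂) * (y₂ - y₃) * (y₁ - y₃)) := by
  have e1 : x₁ * x₂ * (y₁ - y₂) = n * (x₂ - x₁) := by linear_combination x₂ * h1 - x₁ * h2
  have e2 : x₂ * x₃ * (y₂ - y₃) = n * (x₃ - x₂) := by linear_combination x₃ * h2 - x₂ * h3
  have e3 : x₁ * x₃ * (y₁ - y₃) = n * (x₃ - x₁) := by linear_combination x₃ * h1 - x₁ * h3
  have hD : x₁ * x₂ * x₃ * ((y₁ - y₂) * (x₃ - x₂) - (x₂ - x₁) * (y₂ - y₃)) =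
      n * ((x₂ - x₁) * (x₃ - x₂) * (x₃ - x₁)) := by
    linear_combination x₃ * (x₃ - x₂) * e1 - x₁ * (x₂ - x₁) * e2
  have hP : (x₁ * x₂ * x₃) ^ 2 * ((y₁ - y₂) * (y₂ - y₃) * (y₁ - y₃)) =
      n ^ 3 * ((x₂ - x₁) * (x₃ - x₂) * (x₃ - x₁)) := by
    calc _ = (x₁ * x₂ * (y₁ - y₂)) * (x₂ * x₃ * (y₂ - y₃)) * (x₁ * x₃ * (y₁ - y₃)) := by ring
      _ = _ := by rw [e1, e2, e3]; ring
  have hX : (x₁ * x₂ * x₃) ^ 2 ≠ 0 := by positivity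
  apply mul_left_cancel₀ hX
  calc _ = n * (x₁ * x₂ * x₃ * ((y₁ - y₂) * (x₃ - x₂) - (x₂ - x₁) * (y₂ - y₃))) ^ 2 := by ring
    _ = (x₂ - x₁) * (x₃ - x₂) * (x₃ - x₁) *
        (n ^ 3 * ((x₂ - x₁) * (x₃ - x₂) * (x₃ - x₁))) := by rw [hD]; ring
    _ = _ := by rw [← hP]; ring

theorem four_mul_mul_mul_add_le_cube {a b : ℤ} (ha : 0 < a) (hb : 0 < b) :
    4 * (a * b * (a + b)) ≤ (a + b) ^ 3 := by
  nlinarith [mul_nonneg (add_pos ha hb).le (sq_nonneg (a - b))]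

/-- If `D = a' * b - a * b'` is positive and `n * D ^ 2` is the product of the gaps, then
`16 * n < (M - 1 / 2) ^ 6` for any bound `M` on the total gaps. -/
theorem sixteen_mul_lt_of_gaps {n a b a' b' M : ℤ} (hn : 0 < n)
    (ha : 0 < a) (hb : 0 < b) (ha' : 0 < a') (hb' : 0 < b')
    (hD : 0 < a' * b - a * b')
    (h : n * (a' * b - a * b') ^ 2 = a * b * (a + b) * (a' * b' * (a' + b')))
    (hM : a + b ≤ M) (hM' : a' + b' ≤ M) :
    16 * (n : ℝ) < ((M : ℝ) - 1 / 2) ^ 6 := by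
  have hle : 16 * (n * (a' * b - a * b') ^ 2) ≤ ((a + b) * (a' + b')) ^ 3 := by
    rw [h, mul_pow]
    calc _ = 4 * (a * b * (a + b)) * (4 * (a' * b' * (a' + b'))) := by ring
      _ ≤ _ := mul_le_mul (four_mul_mul_mul_add_le_cube ha hb)
        (four_mul_mul_mul_add_le_cube ha' hb') (by positivity) (by positivity)
  by_cases hc : a + b = a' + b'
  · have hDc : a' * b - a * b' = (a + b) * (a' - a) := by
      linear_combination a * hc
    have haa : 0 < a' - a := by
      rw [hDc] at hD
      exact pos_of_mul_pos_right hD (by positivity)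
    have h3 : 3 ≤ M := by omega
    have hcD : (a + b) ^ 2 ≤ (a' * b - a * b') ^ 2 := by
      rw [hDc]
      exact pow_le_pow_left₀ (by positivity) (le_mul_of_one_le_right (by positivity) haa) 2
    have hn4 : 16 * n ≤ (a + b) ^ 4 := by
      have hpos : 0 < (a + b) ^ 2 := by positivity
      refine le_of_mul_le_mul_right ?_ hpos
      calc 16 * n * (a + b) ^ 2 ≤ 16 * n * (a' * b - a * b') ^ 2 := by gcongr
        _ ≤ ((a + b) * (a' + b')) ^ 3 := by rw [mul_assoc]; exact hle
        _ = (a + b) ^ 4 * (a + b) ^ 2 := by rw [← hc]; ring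
    have hnM : (16 : ℝ) * n ≤ (M : ℝ) ^ 4 := by
      exact_mod_cast hn4.trans (pow_le_pow_left₀ (by positivity) hM 4)
    have h3' : (3 : ℝ) ≤ M := by exact_mod_cast h3
    have hsq : (M : ℝ) ^ 2 < ((M : ℝ) - 1 / 2) ^ 3 := by
      nlinarith [mul_nonneg (sub_nonneg.2 h3') (sq_nonneg ((M : ℝ) - 1 / 2))]
    calc (16 : ℝ) * n ≤ ((M : ℝ) ^ 2) ^ 2 := by rw [← pow_mul]; exact hnM
      _ < (((M : ℝ) - 1 / 2) ^ 3) ^ 2 := pow_lt_pow_left₀ hsq (by positivity) two_ne_zero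
      _ = _ := by ring
  · have hcc : (a + b) * (a' + b') ≤ M * (M - 1) := by
      rcases lt_or_gt_of_ne hc with hlt | hlt
      · rw [mul_comm M]
        exact mul_le_mul (by omega) hM' (by positivity) (by omega)
      · exact mul_le_mul hM (by omega) (by positivity) (by omega)
    have hnM : 16 * n ≤ (M * (M - 1)) ^ 3 := by
      calc 16 * n ≤ 16 * (n * (a' * b - a * b') ^ 2) := by
            gcongr
            exact le_mul_of_one_le_right hn.le (one_le_pow₀ hD)
        _ ≤ ((a + b) * (a' + b')) ^ 3 := hle
        _ ≤ _ := pow_le_pow_left₀ (by positivity) hcc 3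
    have hM2 : (2 : ℝ) ≤ M := by exact_mod_cast (show (2 : ℤ) ≤ M by omega)
    have hnM' : (16 : ℝ) * n ≤ ((M : ℝ) * (M - 1)) ^ 3 := by exact_mod_cast hnM
    have hsq : (M : ℝ) * (M - 1) < ((M : ℝ) - 1 / 2) ^ 2 := by nlinarith
    calc (16 : ℝ) * n ≤ ((M : ℝ) * (M - 1)) ^ 3 := hnM'
      _ < (((M : ℝ) - 1 / 2) ^ 2) ^ 3 :=
        pow_lt_pow_left₀ hsq (mul_nonneg (by linarith) (by linarith)) three_ne_zero
      _ = _ := by ring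

theorem two_rpow_mul_rpow_pow_six {r : ℝ} (hr : 0 ≤ r) :
    ((2 : ℝ) ^ ((2 : ℝ) / 3) * r ^ ((1 : ℝ) / 6)) ^ 6 = 16 * r := by
  rw [mul_pow, ← Real.rpow_mul_natCast (by norm_num), ← Real.rpow_mul_natCast hr]
  norm_num

/-- Corollary 1 (first half): if `(x₁,y₁)`, `(x₂,y₂)`, `(x₃,y₃)` are three
lattice points on the hyperbola `x·y = n` with `x₁ < x₂ < x₃`, then
`max(x₃ − x₁, y₁ − y₃) > 2^(2/3)·n^(1/6) + 0.5`. -/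
theorem lattice_points_on_hyperbola_lower_bound
    (n x₁ y₁ x₂ y₂ x₃ y₃ : ℕ) (hn : 0 < n)
    (hx₁ : 0 < x₁) (hy₁ : 0 < y₁) (hx₂ : 0 < x₂) (hy₂ : 0 < y₂)
    (hx₃ : 0 < x₃) (hy₃ : 0 < y₃)
    (h1 : x₁ * y₁ = n) (h2 : x₂ * y₂ = n) (h3 : x₃ * y₃ = n)
    (h12 : x₁ < x₂) (h23 : x₂ < x₃) :
    max ((x₃ : ℝ) - (x₁ : ℝ)) ((y₁ : ℝ) - (y₃ : ℝ)) >
      (2 : ℝ) ^ ((2 : ℝ) / 3) * (n : ℝ) ^ ((1 : ℝ) / 6) + 0.5 := by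
  have hy12 : y₂ < y₁ := by
    by_contra! hle
    exact (Nat.mul_lt_mul_of_lt_of_le h12 hle hy₂).ne (h1.trans h2.symm)
  have hy23 : y₃ < y₂ := by
    by_contra! hle
    exact (Nat.mul_lt_mul_of_lt_of_le h23 hle hy₃).ne (h2.trans h3.symm)
  zify at hn hx₁ hy₁ hx₂ hy₂ hx₃ hy₃ h1 h2 h3 h12 h23 hy12 hy23
  have hdet := hyperbola_mul_det_sq hx₁.ne' hx₂.ne' hx₃.ne' h1 h2 h3
  have hX : (0 : ℤ) < x₁ * x₂ * x₃ := by positivity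
  have hD : (0 : ℤ) < (y₁ - y₂) * (x₃ - x₂) - (x₂ - x₁) * (y₂ - y₃) := by
    refine pos_of_mul_pos_right (a := (x₁ * x₂ * x₃ : ℤ)) ?_ hX.le
    have hprod : (0 : ℤ) < n * ((x₂ - x₁) * (x₃ - x₂) * (x₃ - x₁)) :=
      mul_pos hn (mul_pos (mul_pos (by omega) (by omega)) (by omega))
    refine hprod.trans_eq (Eq.symm ?_)
    linear_combination (x₂ * x₃ * (x₃ - x₂) : ℤ) * h1 - (x₁ * x₃ * (x₃ - x₁) : ℤ) * h2 +
      (x₁ * x₂ * (x₂ - x₁) : ℤ) * h3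
  have key := sixteen_mul_lt_of_gaps (n := n) (a := x₂ - x₁) (b := x₃ - x₂)
    (a' := y₁ - y₂) (b' := y₂ - y₃) (M := max ((x₃ : ℤ) - x₁) ((y₁ : ℤ) - y₃)) hn
    (by omega) (by omega) (by omega) (by omega) hD
    (by linear_combination hdet) (by omega) (by omega)
  have hM : (1 : ℝ) ≤ max ((x₃ : ℝ) - x₁) ((y₁ : ℝ) - y₃) := by
    refine le_max_of_le_left ?_
    exact_mod_cast (show (1 : ℤ) ≤ x₃ - x₁ by omega)
  push_cast at key
  rw [← two_rpow_mul_rpow_pow_six (Nat.cast_nonneg n)] at key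
  have hlt := lt_of_pow_lt_pow_left₀ 6 (by linarith) key
  rw [gt_iff_lt, show (0.5 : ℝ) = 1 / 2 by norm_num]
  exact lt_sub_iff_add_lt.1 hlt
end

section
/- There exist infinitely many positive integers n such that the hyperbola x·y = n contains three points (x₁, y₁), (x₂, y₂), (x₃, y₃) with positive integer coordinates, x₁ < x₂ < x₃, and max(x₃ − x₁, y₁ − y₃) < 2^{2/3}·n^{1/6} + 1.2 (as real numbers). More precisely, for all sufficiently large positive integers N, the number n = N·(N+1)²·(N+2)·(2N+1)·(2N+3) has three such lattice points with x₁ = (2N+1)·N·(N+2), x₂ = x₁ + N, x₃ = x₁ + (2N+1), y₁ = (2N+3)·(N+1)², y₂ = y₁ − (N+1), y₃ = y₁ − (2N+3), and max(x₃ − x₁, y₁ − y₃) = 2N+3 < 2^{2/3}·n^{1/6} + 1.2. -/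
theorem lt_two_rpow_mul_rpow_of_pow_six_lt {t m : ℝ} (hm : 0 ≤ m) (h : t ^ 6 < 16 * m) :
    t < (2 : ℝ) ^ ((2 : ℝ) / 3) * m ^ ((1 : ℝ) / 6) := by
  refine lt_of_pow_lt_pow_left₀ 6 (by positivity) ?_
  rw [mul_pow, ← Real.rpow_mul_natCast (by norm_num), ← Real.rpow_mul_natCast hm]
  norm_num
  exact h

/-- The explicit family of triples of lattice points on a hyperbola. -/
theorem explicit_lattice_triple (N : ℕ) (hN : 10 ≤ N) :
    let n := N * (N + 1) ^ 2 * (N + 2) * (2 * N + 1) * (2 * N + 3)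
    let x₁ := (2 * N + 1) * N * (N + 2)
    let x₂ := x₁ + N
    let x₃ := x₁ + (2 * N + 1)
    let y₁ := (2 * N + 3) * (N + 1) ^ 2
    let y₂ := y₁ - (N + 1)
    let y₃ := y₁ - (2 * N + 3)
    x₁ * y₁ = n ∧ x₂ * y₂ = n ∧ x₃ * y₃ = n ∧
    x₁ < x₂ ∧ x₂ < x₃ ∧
    max (x₃ - x₁) (y₁ - y₃) = 2 * N + 3 ∧
    ((2 * N + 3 : ℕ) : ℝ) <
      (2 : ℝ) ^ ((2 : ℝ) / 3) * (n : ℝ) ^ ((1 : ℝ) / 6) + 1.2 := by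
  intro n x₁ x₂ x₃ y₁ y₂ y₃
  have hy₂ : y₂ = (N + 1) * (2 * N + 1) * (N + 2) :=
    Nat.sub_eq_of_eq_add (by ring)
  have hy₃ : y₃ = (2 * N + 3) * (N * (N + 2)) :=
    Nat.sub_eq_of_eq_add (by ring)
  have hy : y₁ = y₃ + (2 * N + 3) := by rw [hy₃]; ring
  refine ⟨by ring, by rw [hy₂]; ring, by rw [hy₃]; ring, by omega, by omega, by omega, ?_⟩
  have key : (2 * (N : ℝ) + 1.8) ^ 6 < 16 * (n : ℝ) := by
    obtain ⟨k, rfl⟩ := Nat.exists_eq_add_of_le hN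
    simp only [n]
    push_cast
    rw [← sub_pos]
    ring_nf
    positivity
  have := lt_two_rpow_mul_rpow_of_pow_six_lt (Nat.cast_nonneg n) key
  push_cast
  linarith


/-- Corollary 1 (second half): there are infinitely many `n` for which the
hyperbola `x·y = n` carries three lattice points `(x₁,y₁)`, `(x₂,y₂)`, `(x₃,y₃)`
with `x₁ < x₂ < x₃` and `max(x₃ − x₁, y₁ − y₃) < 2^(2/3)·n^(1/6) + 1.2`.
More precisely, for all sufficiently large `N` the number
`n = N(N+1)²(N+2)(2N+1)(2N+3)` carries the explicit triple of lattice points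
described below, with `max(x₃ − x₁, y₁ − y₃) = 2N + 3 < 2^(2/3)·n^(1/6) + 1.2`. -/
theorem lattice_points_on_hyperbola_upper_bound :
    {n : ℕ | 0 < n ∧ ∃ x₁ y₁ x₂ y₂ x₃ y₃ : ℕ,
        0 < x₁ ∧ 0 < y₁ ∧ 0 < x₂ ∧ 0 < y₂ ∧ 0 < x₃ ∧ 0 < y₃ ∧
        x₁ * y₁ = n ∧ x₂ * y₂ = n ∧ x₃ * y₃ = n ∧
        x₁ < x₂ ∧ x₂ < x₃ ∧
        max ((x₃ : ℝ) - (x₁ : ℝ)) ((y₁ : ℝ) - (y₃ : ℝ)) <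
          (2 : ℝ) ^ ((2 : ℝ) / 3) * (n : ℝ) ^ ((1 : ℝ) / 6) + 1.2}.Infinite
    ∧
    ∃ N₀ : ℕ, ∀ N : ℕ, N₀ ≤ N →
      let n := N * (N + 1) ^ 2 * (N + 2) * (2 * N + 1) * (2 * N + 3)
      let x₁ := (2 * N + 1) * N * (N + 2)
      let x₂ := x₁ + N
      let x₃ := x₁ + (2 * N + 1)
      let y₁ := (2 * N + 3) * (N + 1) ^ 2
      let y₂ := y₁ - (N + 1)
      let y₃ := y₁ - (2 * N + 3)
      x₁ * y₁ = n ∧ x₂ * y₂ = n ∧ x₃ * y₃ = n ∧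
      x₁ < x₂ ∧ x₂ < x₃ ∧
      max (x₃ - x₁) (y₁ - y₃) = 2 * N + 3 ∧
      ((2 * N + 3 : ℕ) : ℝ) <
        (2 : ℝ) ^ ((2 : ℝ) / 3) * (n : ℝ) ^ ((1 : ℝ) / 6) + 1.2 := by
  refine ⟨Set.infinite_of_forall_exists_gt fun a => ?_, 10, explicit_lattice_triple⟩
  obtain ⟨N, hN, haN⟩ : ∃ N, 10 ≤ N ∧ a < N := ⟨a + 10, by omega, by omega⟩
  obtain ⟨h₁, h₂, h₃, hx₁₂, hx₂₃, hmax, hlt⟩ := explicit_lattice_triple N hN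
  have hn : N ≤ N * (N + 1) ^ 2 * (N + 2) * (2 * N + 1) * (2 * N + 3) := by
    simp only [mul_assoc]
    exact Nat.le_mul_of_pos_right N (by positivity)
  have hpos := (by omega : 0 < N).trans_le hn
  refine ⟨_, ⟨hpos, _, _, _, _, _, _, ?_, ?_, ?_, ?_, ?_, ?_, h₁, h₂, h₃, hx₁₂, hx₂₃,
    lt_of_le_of_lt ?_ hlt⟩, haN.trans_le hn⟩
  · exact Nat.pos_of_mul_pos_right (h₁ ▸ hpos)
  · exact Nat.pos_of_mul_pos_left (h₁ ▸ hpos)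
  · exact Nat.pos_of_mul_pos_right (h₂ ▸ hpos)
  · exact Nat.pos_of_mul_pos_left (h₂ ▸ hpos)
  · exact Nat.pos_of_mul_pos_right (h₃ ▸ hpos)
  · exact Nat.pos_of_mul_pos_left (h₃ ▸ hpos)
  · have cast_sub_le (p q : ℕ) : (p : ℝ) - q ≤ ((p - q : ℕ) : ℝ) :=
      sub_le_iff_le_add.2 (mod_cast le_tsub_add)
    exact (max_le_max (cast_sub_le _ _) (cast_sub_le _ _)).trans_eq
      ((Nat.cast_max _ _).symm.trans (congrArg Nat.cast hmax))
end

section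
/- Let A, B, a, b be positive integers with A·B = (A + a)·(B − b). Let d = gcd(a, b), a' = a/d, b' = b/d. Then a' divides A and b' divides B, and writing A = a'·A', B = b'·B', one has B' = A' + d. Consequently n = A·B can be written as n = (a'·A')·(b'·(A' + d)) = (a'·(A' + d))·(b'·A'). -/
/-- Structure of a pair of close factorizations: if `A·B = (A+a)·(B−b)` and
`d = gcd(a,b)`, `a' = a/d`, `b' = b/d`, then `a' ∣ A`, `b' ∣ B`, and writing
`A = a'·A'`, `B = b'·B'` one has `B' = A' + d`; hence
`n = (a'·A')·(b'·(A'+d)) = (a'·(A'+d))·(b'·A')`. -/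
theorem two_close_factorizations_structure (A B a b : ℕ)
    (hA : 0 < A) (hB : 0 < B) (ha : 0 < a) (hb : 0 < b)
    (h : A * B = (A + a) * (B - b)) :
    (a / Nat.gcd a b) ∣ A ∧ (b / Nat.gcd a b) ∣ B ∧
    ∃ A' B' : ℕ,
      A = (a / Nat.gcd a b) * A' ∧ B = (b / Nat.gcd a b) * B' ∧
      B' = A' + Nat.gcd a b ∧
      A * B = ((a / Nat.gcd a b) * A') * ((b / Nat.gcd a b) * (A' + Nat.gcd a b)) ∧
      A * B = ((a / Nat.gcd a b) * (A' + Nat.gcd a b)) * ((b / Nat.gcd a b) * A') := by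
  have hbB : b ≤ B := by
    by_contra! hlt
    rw [Nat.sub_eq_zero_of_le hlt.le, mul_zero] at h
    exact (Nat.mul_pos hA hB).ne' h
  obtain ⟨C, rfl⟩ := Nat.exists_eq_add_of_le hbB
  rw [Nat.add_sub_cancel_left] at h
  have hd : 0 < Nat.gcd a b := Nat.gcd_pos_of_pos_left b ha
  have hcop := Nat.coprime_div_gcd_div_gcd hd
  have hpa := Nat.div_mul_cancel (Nat.gcd_dvd_left a b)
  have hqb := Nat.div_mul_cancel (Nat.gcd_dvd_right a b)
  have hp : 0 < a / Nat.gcd a b := Nat.div_gcd_pos_of_pos_left b ha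
  generalize Nat.gcd a b = d at *
  generalize a / d = p at *
  generalize b / d = q at *
  subst hpa hqb
  have hAq : A * q = p * C := by
    apply Nat.eq_of_mul_eq_mul_right hd
    linarith
  obtain ⟨A', rfl⟩ : p ∣ A := hcop.dvd_of_dvd_mul_right ⟨C, hAq⟩
  obtain rfl : C = q * A' := by
    apply Nat.eq_of_mul_eq_mul_left hp
    linarith
  exact ⟨⟨A', rfl⟩, ⟨A' + d, by ring⟩, A', A' + d, rfl, by ring, rfl, by ring, by ring⟩
end

section
/- Suppose positive integers A, B, a₁, a₂, b₁, b₂ satisfy A·B = (A + a₁)·(B − b₁) = (A + a₂)·(B − b₂) with a₁ < a₂ and b₁ < b₂. Then a₂·b₁ > a₁·b₂, and moreover (a₂·b₁ − a₁·b₂)·B = b₁·b₂·(a₂ − a₁) and (a₂·b₁ − a₁·b₂)·A = a₁·a₂·(b₂ − b₁). -/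
/-- If `A·B = (A+a₁)·(B−b₁) = (A+a₂)·(B−b₂)` with `a₁ < a₂` and `b₁ < b₂`, then
`a₂·b₁ > a₁·b₂`, `(a₂·b₁ − a₁·b₂)·B = b₁·b₂·(a₂ − a₁)` and
`(a₂·b₁ − a₁·b₂)·A = a₁·a₂·(b₂ − b₁)`. -/
theorem three_factorizations_key_identity (A B a₁ a₂ b₁ b₂ : ℕ)
    (hA : 0 < A) (hB : 0 < B) (ha₁ : 0 < a₁) (hb₁ : 0 < b₁)
    (ha₁₂ : a₁ < a₂) (hb₁₂ : b₁ < b₂)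
    (h1 : A * B = (A + a₁) * (B - b₁))
    (h2 : A * B = (A + a₂) * (B - b₂)) :
    a₂ * b₁ > a₁ * b₂ ∧
    (a₂ * b₁ - a₁ * b₂) * B = b₁ * b₂ * (a₂ - a₁) ∧
    (a₂ * b₁ - a₁ * b₂) * A = a₁ * a₂ * (b₂ - b₁) := by
  have hb₂B : b₂ < B := by
    refine Nat.lt_of_sub_pos (Nat.pos_of_ne_zero fun h => ?_)
    rw [h, mul_zero] at h2
    exact (Nat.mul_pos hA hB).ne' h2
  have hb₁B : b₁ < B := hb₁₂.trans hb₂B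
  zify [hb₁B.le] at h1
  zify [hb₂B.le] at h2
  have eqB : ((a₂ : ℤ) * b₁ - a₁ * b₂) * B = b₁ * b₂ * (a₂ - a₁) := by
    linear_combination (b₂ : ℤ) * h1 - b₁ * h2
  have eqA : ((a₂ : ℤ) * b₁ - a₁ * b₂) * A = a₁ * a₂ * (b₂ - b₁) := by
    linear_combination (a₂ : ℤ) * h1 - a₁ * h2
  have hlt : a₁ * b₂ < a₂ * b₁ := by
    have hpos : (0 : ℤ) < b₁ * b₂ * (a₂ - a₁) := by
      have hb₂ : 0 < b₂ := hb₁.trans hb₁₂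
      have hsub : (0 : ℤ) < a₂ - a₁ := sub_pos.mpr (by exact_mod_cast ha₁₂)
      positivity
    rw [← eqB] at hpos
    exact_mod_cast sub_pos.mp (pos_of_mul_pos_left hpos (Int.natCast_nonneg B))
  refine ⟨hlt, ?_, ?_⟩
  · zify [hlt.le, ha₁₂.le]
    exact eqB
  · zify [hlt.le, hb₁₂.le]
    exact eqA
end

section
/- Let A, B, a be positive integers with a ≥ 2 and A·B = (A + a)·(B − (a − 1)). Then a divides A and, writing A = a·A', one has B = (a − 1)·(A' + 1). -/
/-- Case `a₂ = b₂ + 1`: if `A·B = (A+a)·(B−(a−1))` with `a ≥ 2`, then `a ∣ A`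
and, writing `A = a·A'`, one has `B = (a−1)·(A'+1)`. -/
theorem factorization_shift_a_minus_one (A B a : ℕ)
    (hA : 0 < A) (hB : 0 < B) (ha : 2 ≤ a)
    (h : A * B = (A + a) * (B - (a - 1))) :
    a ∣ A ∧ ∃ A' : ℕ, A = a * A' ∧ B = (a - 1) * (A' + 1) := by
  obtain ⟨c, rfl⟩ : ∃ c, a = c + 1 := ⟨a - 1, by omega⟩
  rw [Nat.add_sub_cancel] at h ⊢
  have hcB : c < B := by
    by_contra! hle
    rw [Nat.sub_eq_zero_of_le hle, mul_zero] at h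
    exact (Nat.mul_pos hA hB).ne' h
  obtain ⟨d, rfl⟩ := Nat.exists_eq_add_of_le hcB.le
  rw [Nat.add_sub_cancel_left] at h
  have hd : A * c = (c + 1) * d := by linarith
  obtain ⟨k, rfl⟩ : c + 1 ∣ A :=
    Nat.Coprime.dvd_of_dvd_mul_right (by simp) (Dvd.intro d hd.symm)
  refine ⟨Dvd.intro k rfl, k, rfl, ?_⟩
  have hk : k * c = d := Nat.eq_of_mul_eq_mul_left c.succ_pos (by rw [← mul_assoc, hd])
  rw [← hk]
  ring
end

section
/- Let A, B, a be positive integers with a ≥ 3 and A·B = (A + a)·(B − (a − 2)). Then there exists a positive integer A' such that 2·A = a·A' and 2·B = (a − 2)·(A' + 2). -/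
/-- Case `a₂ = b₂ + 2`: if `A·B = (A+a)·(B−(a−2))` with `a ≥ 3`, then there is
a positive integer `A'` with `2A = a·A'` and `2B = (a−2)·(A'+2)`. -/
theorem factorization_shift_a_minus_two (A B a : ℕ)
    (hA : 0 < A) (hB : 0 < B) (ha : 3 ≤ a)
    (h : A * B = (A + a) * (B - (a - 2))) :
    ∃ A' : ℕ, 0 < A' ∧ 2 * A = a * A' ∧ 2 * B = (a - 2) * (A' + 2) := by
  obtain ⟨b, rfl⟩ : ∃ b, a = b + 2 := ⟨a - 2, by omega⟩
  rw [Nat.add_sub_cancel] at h ⊢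
  have hbB : b < B := by
    by_contra! hle
    rw [Nat.sub_eq_zero_of_le hle, mul_zero] at h
    exact (Nat.mul_pos hA hB).ne' h
  obtain ⟨C, rfl⟩ := Nat.exists_eq_add_of_lt hbB
  rw [show b + C + 1 - b = C + 1 by omega] at h
  have hAC : C + 1 < A := by
    by_contra! hle
    nlinarith [Nat.mul_le_mul_left b hle]
  obtain ⟨D, rfl⟩ := Nat.exists_eq_add_of_lt hAC
  exact ⟨D + 1, D.succ_pos, by linarith, by linarith⟩
end

section
/- Let A, B, a be positive integers with a ≥ 3 and A·B = (A + (a − 2))·(B − a). Then there exists a positive integer A' such that 2·A = (a − 2)·A' and 2·B = a·(A' + 2). -/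
/-- Case `b₂ = a₂ + 2`: if `A·B = (A+(a−2))·(B−a)` with `a ≥ 3`, then there is
a positive integer `A'` with `2A = (a−2)·A'` and `2B = a·(A'+2)`. -/
theorem factorization_shift_a_plus_two (A B a : ℕ)
    (hA : 0 < A) (hB : 0 < B) (ha : 3 ≤ a)
    (h : A * B = (A + (a - 2)) * (B - a)) :
    ∃ A' : ℕ, 0 < A' ∧ 2 * A = (a - 2) * A' ∧ 2 * B = a * (A' + 2) := by
  obtain ⟨k, rfl⟩ : ∃ k, a = k + 2 := ⟨a - 2, by omega⟩
  have hk : 0 < k := by omega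
  have hlt : k + 2 < B := by
    by_contra! hle
    rw [Nat.sub_eq_zero_of_le hle, mul_zero] at h
    exact (Nat.mul_pos hA hB).ne' h
  obtain ⟨c, rfl⟩ := Nat.exists_eq_add_of_lt hlt
  rw [Nat.add_sub_cancel, show k + 2 + c + 1 - (k + 2) = c + 1 by omega] at h
  have hc : A * (k + 2) = k * (c + 1) := by linarith
  have hAc : A < c + 1 := by
    by_contra! hle
    nlinarith [Nat.mul_le_mul_left k hle]
  obtain ⟨d, hd⟩ := Nat.exists_eq_add_of_lt hAc
  have hAd : 2 * A = k * (d + 1) := by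
    rw [hd] at hc
    linarith
  refine ⟨d + 1, d.succ_pos, hAd, ?_⟩
  linarith
end

section
/- Let a, h, k be positive integers with a ≥ 3, 0 < h < a, 0 < k < a − 2, and (a − h)·(a − 2 − k) = h·k + 1. Then a is odd, 2·h = a + 1, and 2·k = a − 3 (in particular a ≥ 5 when k ≥ 1). -/
/-- Diophantine condition: if `a ≥ 3`, `0 < h < a`, `0 < k < a − 2` and
`(a−h)·(a−2−k) = h·k + 1`, then `a` is odd, `2h = a + 1` and `2k = a − 3`
(in particular `a ≥ 5`). -/
theorem consecutive_divisor_condition_two (a h k : ℕ)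
    (ha : 3 ≤ a) (hh : 0 < h) (hha : h < a) (hk : 0 < k) (hka : k < a - 2)
    (h1 : (a - h) * (a - 2 - k) = h * k + 1) :
    Odd a ∧ 2 * h = a + 1 ∧ 2 * k = a - 3 ∧ 5 ≤ a := by
  have hmul : (a : ℤ) * (h + k + 2 - a) = 2 * h - 1 := by
    zify [hha.le, hka.le, show 2 ≤ a by lia] at h1
    linear_combination -h1
  have hquot : (h + k + 2 - a : ℤ) = 1 := by
    have hpos : (0 : ℤ) < h + k + 2 - a :=
      pos_of_mul_pos_right (by rw [hmul]; lia) (Int.natCast_nonneg a)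
    have hlt : (h + k + 2 - a : ℤ) < 2 :=
      lt_of_mul_lt_mul_left (by rw [hmul]; lia) (Int.natCast_nonneg a)
    lia
  rw [hquot] at hmul
  exact ⟨⟨h - 1, by lia⟩, by lia, by lia, by lia⟩
end

section
/- Let a, h, k be positive integers with a ≥ 3, 0 < h < a − 2, 0 < k < a, and (a − 2 − h)·(a − k) = h·k + 1. Then a is odd, 2·k = a + 1, and 2·h = a − 3. -/
/-- Mirror Diophantine condition: if `a ≥ 3`, `0 < h < a − 2`, `0 < k < a` and
`(a−2−h)·(a−k) = h·k + 1`, then `a` is odd, `2k = a + 1` and `2h = a − 3`. -/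
theorem consecutive_divisor_condition_three (a h k : ℕ)
    (ha : 3 ≤ a) (hh : 0 < h) (hha : h < a - 2) (hk : 0 < k) (hka : k < a)
    (h1 : (a - 2 - h) * (a - k) = h * k + 1) :
    Odd a ∧ 2 * k = a + 1 ∧ 2 * h = a - 3 := by
  obtain ⟨m, rfl⟩ : ∃ m, a = m + h + 2 := ⟨a - 2 - h, by omega⟩
  have hm : m + h + 2 - 2 - h = m := by omega
  rw [hm] at h1
  zify [hka.le] at h1 hk hka
  -- The condition says that `a` divides `2 * k - 1`, with quotient `k - m`.
  have hdiv : ((m : ℤ) + h + 2) * (k - m) = 2 * k - 1 := by linear_combination -h1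
  have hpos : (0 : ℤ) < k - m := by
    by_contra! hle
    nlinarith
  have hlt : (k - m : ℤ) < 2 := by
    by_contra! hge
    nlinarith
  have hq : (k - m : ℤ) = 1 := by omega
  rw [hq] at hdiv
  refine ⟨⟨m, ?_⟩, ?_, ?_⟩ <;> omega
end

section
/- Let C ≥ 3 be an integer. Suppose positive integers A, B, a₁, a₂, b₁, b₂ satisfy A·B = (A + a₁)·(B − b₁) = (A + a₂)·(B − b₂) with 1 ≤ a₁ < a₂ ≤ C − 3 and 1 ≤ b₁ < b₂ ≤ C. Then B < C²·(C − 3)/4 + C (as rational numbers). -/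
/-- Case 5 of Theorem 2: if `A·B = (A+a₁)·(B−b₁) = (A+a₂)·(B−b₂)` with
`1 ≤ a₁ < a₂ ≤ C − 3` and `1 ≤ b₁ < b₂ ≤ C`, then `B < C²·(C−3)/4 + C`
as rational numbers. -/
theorem three_factorizations_case_five_bound (C A B a₁ a₂ b₁ b₂ : ℕ)
    (hC : 3 ≤ C) (hA : 0 < A) (hB : 0 < B)
    (ha₁ : 1 ≤ a₁) (ha₁₂ : a₁ < a₂) (ha₂ : a₂ ≤ C - 3)
    (hb₁ : 1 ≤ b₁) (hb₁₂ : b₁ < b₂) (hb₂ : b₂ ≤ C)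
    (h1 : A * B = (A + a₁) * (B - b₁))
    (h2 : A * B = (A + a₂) * (B - b₂)) :
    (B : ℚ) < (C : ℚ) ^ 2 * ((C : ℚ) - 3) / 4 + (C : ℚ) := by
  have hB₁ : b₁ < B := by
    by_contra! h
    rw [Nat.sub_eq_zero_of_le h, mul_zero] at h1
    exact (Nat.mul_pos hA hB).ne' h1
  have hB₂ : b₂ < B := by
    by_contra! h
    rw [Nat.sub_eq_zero_of_le h, mul_zero] at h2
    exact (Nat.mul_pos hA hB).ne' h2
  have hC' : a₂ + 3 ≤ C := by omega
  clear ha₂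
  have key : 4 * ((B : ℤ) - b₂) < (C : ℤ) ^ 2 * (C - 3) := by
    zify [hB₁.le, hB₂.le] at *
    generalize (A : ℤ) = A, (B : ℤ) = B, (C : ℤ) = C, (a₁ : ℤ) = a₁, (a₂ : ℤ) = a₂,
      (b₁ : ℤ) = b₁, (b₂ : ℤ) = b₂ at *
    have hD : (B - b₂) * (a₂ * b₁ - a₁ * b₂) = a₁ * b₂ * (b₂ - b₁) := by
      linear_combination b₂ * h1 - b₁ * h2
    have hpos : 0 < a₁ * b₂ * (b₂ - b₁) :=
      mul_pos (mul_pos (by linarith) (by linarith)) (by linarith)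
    have hD1 : 0 < a₂ * b₁ - a₁ * b₂ :=
      pos_of_mul_pos_right (hD ▸ hpos) (by linarith)
    have hle : B - b₂ ≤ a₁ * b₂ * (b₂ - b₁) := by
      rw [← hD]
      exact le_mul_of_one_le_right (by linarith) hD1
    have hlt : a₁ * b₂ * (b₂ - b₁) < a₂ * b₁ * (b₂ - b₁) :=
      mul_lt_mul_of_pos_right (by linarith) (by linarith)
    have hsq : 4 * (b₁ * (b₂ - b₁)) ≤ C ^ 2 := by
      nlinarith [sq_nonneg (b₂ - 2 * b₁)]
    have hmul : 4 * (b₁ * (b₂ - b₁)) * a₂ ≤ C ^ 2 * (C - 3) :=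
      mul_le_mul hsq (by linarith) (by linarith) (sq_nonneg C)
    linarith
  have key' : 4 * ((B : ℚ) - b₂) < (C : ℚ) ^ 2 * (C - 3) := by exact_mod_cast key
  have hb₂' : (b₂ : ℚ) ≤ C := by exact_mod_cast hb₂
  linarith
end
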